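/- Let μ and ν be integrable measures on ℝⁿ, each concentrated on A_{[n]} = {x ∈ ℝⁿ : x_i ≠ 0 for all i}, and let J ⊆ [n]. Then δ_J⊛μ⊛ν ≠ 0 if and only if δ_J⊛μ ≠ 0 and δ_J⊛ν ≠ 0. -/

import Mathlib

open MeasureTheory
open scoped ENNReal symmDiff Classical

noncomputable section

/-- The Euclidean (ℓ²) norm on `Fin n → ℝ`. -/
def e2 {n : ℕ} (x : Fin n → ℝ) : ℝ := Real.sqrt (∑ i, (x i) ^ 2)

/-- The unit sphere `S^{n-1}` in `ℝⁿ`. -/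
def Sph (n : ℕ) : Set (Fin n → ℝ) := {x | e2 x = 1}

/-- The set `A_E = {x : xᵢ ≠ 0 ↔ i ∈ E}`. -/
def setA {n : ℕ} (E : Finset (Fin n)) : Set (Fin n → ℝ) := {x | ∀ i, x i ≠ 0 ↔ i ∈ E}

/-- Finite signed Borel measures on `ℝⁿ`. -/
abbrev SM (n : ℕ) := MeasureTheory.SignedMeasure (Fin n → ℝ)

/-- A (finite) measure regarded as a signed measure (junk value `0` if not finite). -/
def toSigned {X : Type*} [MeasurableSpace X] (ρ : Measure X) : SignedMeasure X :=
  if h : IsFiniteMeasure ρ then @Measure.toSignedMeasure X _ ρ h else 0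

/-- Multiplicative convolution of two non-negative measures. -/
def mconvPos {n : ℕ} (ρ σ : Measure (Fin n → ℝ)) : Measure (Fin n → ℝ) :=
  (ρ.prod σ).map (fun p => p.1 * p.2)

/-- Multiplicative convolution `μ ⊛ ν` of two signed measures, via Jordan decomposition. -/
def mconv {n : ℕ} (μ ν : SM n) : SM n :=
  toSigned (mconvPos μ.toJordanDecomposition.posPart ν.toJordanDecomposition.posPart
      + mconvPos μ.toJordanDecomposition.negPart ν.toJordanDecomposition.negPart)
  - toSigned (mconvPos μ.toJordanDecomposition.posPart ν.toJordanDecomposition.negPart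
      + mconvPos μ.toJordanDecomposition.negPart ν.toJordanDecomposition.posPart)

/-- `μ` is integrable: `∫ ‖x‖₂ d|μ| < ∞`. -/
def IntegrableSM {n : ℕ} (μ : SM n) : Prop :=
  ∫⁻ x, ENNReal.ofReal (e2 x) ∂μ.totalVariation < ⊤

/-- `μ` is concentrated on `A`:  `|μ|(Aᶜ) = 0`. -/
def ConcOn {n : ℕ} (μ : SM n) (A : Set (Fin n → ℝ)) : Prop := μ.totalVariation Aᶜ = 0

/-- The multiple reflection `T_E` on `ℝⁿ`. -/
def flipE {n : ℕ} (E : Finset (Fin n)) (x : Fin n → ℝ) : Fin n → ℝ :=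
  fun i => if i ∈ E then -x i else x i

/-- Pushforward of a signed measure under `T_E`. -/
def Tmap {n : ℕ} (E : Finset (Fin n)) (μ : SM n) : SM n := μ.map (flipE E)

def EvenUnder {n : ℕ} (μ : SM n) (E : Finset (Fin n)) : Prop := Tmap E μ = μ
def OddUnder {n : ℕ} (μ : SM n) (E : Finset (Fin n)) : Prop := Tmap E μ = -μ

/-- Orthogonal projection onto the coordinate subspace `H_E`. -/
def projE {n : ℕ} (E : Finset (Fin n)) (x : Fin n → ℝ) : Fin n → ℝ :=
  fun i => if i ∈ E then x i else 0

/-- `P_E(μ)`: pushforward under `projE`. -/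
def Pmap {n : ℕ} (E : Finset (Fin n)) (μ : SM n) : SM n := μ.map (projE E)

/-- `R_E(μ) = μ_E`: restriction to `A_E`. -/
def Rres {n : ℕ} (E : Finset (Fin n)) (μ : SM n) : SM n := μ.restrict (setA E)

/-- Sign vector attached to `b : Fin n → Bool`. -/
def signVec {n : ℕ} (b : Fin n → Bool) : Fin n → ℝ := fun i => if b i then 1 else -1

/-- The measure `δ_J = 2^{-n} ∑_{s ∈ 𝒮ⁿ} σ_J(s) δ_s`. -/
def deltaJ {n : ℕ} (J : Finset (Fin n)) : SM n :=
  ((2 : ℝ) ^ n)⁻¹ •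
    ∑ b : Fin n → Bool,
      (∏ j ∈ J, (if b j then (1 : ℝ) else -1)) • toSigned (Measure.dirac (signVec b))

/-- `𝒥(E; Fe, Fo)`. -/
def JsetE {n : ℕ} (E : Finset (Fin n)) (Fe Fo : Set (Finset (Fin n))) :
    Set (Finset (Fin n)) :=
  {J | J ⊆ E ∧ (∀ F ∈ Fe, Even (J ∩ F).card) ∧ (∀ F ∈ Fo, Odd (J ∩ F).card)}

/-- `𝒥(Fe, Fo) = 𝒥([n]; Fe, Fo)`. -/
def Jset {n : ℕ} (Fe Fo : Set (Finset (Fin n))) : Set (Finset (Fin n)) :=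
  {J | (∀ F ∈ Fe, Even (J ∩ F).card) ∧ (∀ F ∈ Fo, Odd (J ∩ F).card)}

/-- `G` has a representation `G = F₁ Δ … Δ F_m` with each `Fᵢ` drawn from `Fe` or `Fo`,
in which the number of terms drawn from `Fo` is even (`odd = false`) or odd (`odd = true`). -/
def HasRep {n : ℕ} (Fe Fo : Set (Finset (Fin n))) (G : Finset (Fin n)) (odd : Bool) : Prop :=
  ∃ l : List (Finset (Fin n) × Bool),
    (∀ p ∈ l, if p.2 then p.1 ∈ Fo else p.1 ∈ Fe) ∧
    (l.map Prod.fst).foldr (· ∆ ·) ∅ = G ∧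
    (l.countP (fun p => p.2)) % 2 = (if odd then 1 else 0)

/-- The generating pair `(Fe, Fo)` is proper: the even and odd parts of the generated group
are disjoint. -/
def ProperPair {n : ℕ} (Fe Fo : Set (Finset (Fin n))) : Prop :=
  ∀ G : Finset (Fin n), ¬ (HasRep Fe Fo G false ∧ HasRep Fe Fo G true)

/-- `ℳ^int(A; Fe, Fo)`: integrable signed measures concentrated on `A`, even under `T_F`
for `F ∈ Fe` and odd under `T_F` for `F ∈ Fo`. -/
def MclassInt {n : ℕ} (A : Set (Fin n → ℝ)) (Fe Fo : Set (Finset (Fin n))) : Set (SM n) :=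
  {μ | IntegrableSM μ ∧ ConcOn μ A ∧ (∀ F ∈ Fe, EvenUnder μ F) ∧ (∀ F ∈ Fo, OddUnder μ F)}

/-- `ν` is universal on `𝒜`. -/
def Universal {n : ℕ} (ν : SM n) (𝒜 : Set (SM n)) : Prop :=
  ∀ μ ∈ 𝒜, mconv ν μ = 0 → μ = 0

/-- Radial projection of a non-negative measure. -/
def radPos {n : ℕ} (ρ : Measure (Fin n → ℝ)) : Measure (Fin n → ℝ) :=
  (ρ.withDensity fun x => ENNReal.ofReal (e2 x)).map (fun x => (e2 x)⁻¹ • x)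

/-- Radial projection `P_S` of a signed measure. -/
def PS {n : ℕ} (μ : SM n) : SM n :=
  toSigned (radPos μ.toJordanDecomposition.posPart) -
    toSigned (radPos μ.toJordanDecomposition.negPart)

/-- The spherical product `μ ⊛_S ν = P_S(μ ⊛ ν)`. -/
def mconvS {n : ℕ} (μ ν : SM n) : SM n := PS (mconv μ ν)

/-- `ν` is spherically universal on `𝒜`. -/
def SphUniversal {n : ℕ} (ν : SM n) (𝒜 : Set (SM n)) : Prop :=
  ∀ μ ∈ 𝒜, mconvS ν μ = 0 → μ = 0

/-- The unconditional symmetrisation `M_unc`. -/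
def Munc {n : ℕ} (μ : SM n) : SM n := ((2 : ℝ) ^ n)⁻¹ • ∑ E : Finset (Fin n), Tmap E μ

/-- Integral of `f` against a signed measure. -/
def sInt {n : ℕ} (μ : SM n) (f : (Fin n → ℝ) → ℝ) : ℝ :=
  (∫ x, f x ∂μ.toJordanDecomposition.posPart) - ∫ x, f x ∂μ.toJordanDecomposition.negPart

/-- `δ₁ ⊗ μ`: the lifting of `μ` to a measure on `ℝ^{n+1}`, with an extra `0`-th coordinate
carrying a unit atom at `1`. -/
def lift0 {n : ℕ} (μ : SM n) : SM (n + 1) := μ.map (fun x => Fin.cons 1 x)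

/-- Symmetrisation about the origin. -/
def Msym {n : ℕ} (μ : SM n) : SM n := (2 : ℝ)⁻¹ • (μ + μ.map (fun x => -x))

/-- The lifting `L(μ) = P_S(M_sym(δ₁ ⊗ μ))`. -/
def Lift {n : ℕ} (μ : SM n) : SM (n + 1) := PS (Msym (lift0 μ))

section LaplaceTransform

open ProbabilityTheory Topology

variable {E : Type*} [NormedAddCommGroup E] [NormedSpace ℝ E]

theorem isOpen_preimage_line {D : Set (StrongDual ℝ E)} (hD : IsOpen D) (L v : StrongDual ℝ E) :
    IsOpen {u : ℝ | L + u • v ∈ D} :=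
  hD.preimage (by fun_prop)

theorem convex_preimage_line {D : Set (StrongDual ℝ E)} (hD : Convex ℝ D)
    (L v : StrongDual ℝ E) : Convex ℝ {u : ℝ | L + u • v ∈ D} := by
  intro x hx y hy s t hs ht hst
  have := hD hx hy hs ht hst
  convert this using 1
  simp only [Set.mem_ofPred_eq, smul_eq_mul]
  congr! 1
  rw [smul_add, smul_add, add_add_add_comm, ← add_smul, hst, one_smul, smul_smul, smul_smul,
    ← add_smul]

variable [MeasurableSpace E]

/-- The measure `e^L • a`. -/
def expTilt (a : Measure E) (L : StrongDual ℝ E) : Measure E :=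
  a.withDensity fun y => ENNReal.ofReal (Real.exp (L y))

/-- The Laplace transform `∫ e^L da`. -/
def laplace (a : Measure E) (L : StrongDual ℝ E) : ℝ := ∫ y, Real.exp (L y) ∂a

theorem isFiniteMeasure_expTilt {a : Measure E} {L : StrongDual ℝ E}
    (h : Integrable (fun y => Real.exp (L y)) a) : IsFiniteMeasure (expTilt a L) :=
  isFiniteMeasure_withDensity_ofReal h.2

variable [BorelSpace E]

theorem measurable_ofReal_exp_dual (L : StrongDual ℝ E) :
    Measurable fun y => ENNReal.ofReal (Real.exp (L y)) :=
  (Real.continuous_exp.comp L.continuous).measurable.ennreal_ofReal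

theorem mgf_expTilt (a : Measure E) (L v : StrongDual ℝ E) (u : ℝ) :
    mgf v (expTilt a L) u = laplace a (L + u • v) := by
  rw [mgf, expTilt, integral_withDensity_eq_integral_toReal_smul (measurable_ofReal_exp_dual L)
    (by simp), laplace]
  refine integral_congr_ae (.of_forall fun y => ?_)
  simp [ENNReal.toReal_ofReal (Real.exp_pos _).le, ← Real.exp_add]

theorem mem_integrableExpSet_expTilt {a : Measure E} {L v : StrongDual ℝ E} {u : ℝ} :
    u ∈ integrableExpSet v (expTilt a L) ↔
      Integrable (fun y => Real.exp ((L + u • v) y)) a := by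
  rw [integrableExpSet, Set.mem_ofPred_eq, expTilt,
    integrable_withDensity_iff_integrable_smul' (measurable_ofReal_exp_dual L) (by simp)]
  refine integrable_congr (.of_forall fun y => ?_)
  simp [ENNReal.toReal_ofReal (Real.exp_pos _).le, ← Real.exp_add]

theorem subset_interior_integrableExpSet {D : Set (StrongDual ℝ E)} (hD : IsOpen D)
    {a : Measure E} (ha : ∀ L ∈ D, Integrable (fun y => Real.exp (L y)) a)
    (L v : StrongDual ℝ E) :
    {u : ℝ | L + u • v ∈ D} ⊆ interior (integrableExpSet v (expTilt a L)) :=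
  interior_maximal (fun _ hu => mem_integrableExpSet_expTilt.2 (ha _ hu))
    (isOpen_preimage_line hD L v)

theorem analyticOnNhd_laplace_line {D : Set (StrongDual ℝ E)} (hD : IsOpen D)
    {a : Measure E} (ha : ∀ L ∈ D, Integrable (fun y => Real.exp (L y)) a)
    (L v : StrongDual ℝ E) :
    AnalyticOnNhd ℝ (fun u : ℝ => laplace a (L + u • v)) {u : ℝ | L + u • v ∈ D} := by
  simp_rw [← mgf_expTilt]
  exact analyticOnNhd_mgf.mono (subset_interior_integrableExpSet hD ha L v)

/-- On an open convex set, if the product of two differences of Laplace transforms vanishes, then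
one of the differences vanishes. -/
theorem laplace_eq_or_eq_of_mul_eq_zero {D : Set (StrongDual ℝ E)} (hD : IsOpen D)
    (hDc : Convex ℝ D) {a b c d : Measure E}
    (ha : ∀ L ∈ D, Integrable (fun y => Real.exp (L y)) a)
    (hb : ∀ L ∈ D, Integrable (fun y => Real.exp (L y)) b)
    (hc : ∀ L ∈ D, Integrable (fun y => Real.exp (L y)) c)
    (hd : ∀ L ∈ D, Integrable (fun y => Real.exp (L y)) d)
    (h : ∀ L ∈ D, (laplace a L - laplace b L) * (laplace c L - laplace d L) = 0) :
    (∀ L ∈ D, laplace a L - laplace b L = 0) ∨ (∀ L ∈ D, laplace c L - laplace d L = 0) := by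
  by_contra! hcon
  obtain ⟨⟨L, hL, hL'⟩, M, hM, hM'⟩ := hcon
  rcases AnalyticOnNhd.eq_zero_or_eq_zero_of_mul_eq_zero
    ((analyticOnNhd_laplace_line hD ha L (M - L)).sub (analyticOnNhd_laplace_line hD hb L (M - L)))
    ((analyticOnNhd_laplace_line hD hc L (M - L)).sub (analyticOnNhd_laplace_line hD hd L (M - L)))
    (fun u hu => h _ hu) (convex_preimage_line hDc L (M - L)).isPreconnected with h0 | h0
  · exact hL' (by simpa using h0 0 (by simpa using hL))
  · exact hM' (by simpa using h0 1 (by simpa using hM))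

/-- Two finite measures whose Laplace transforms are finite and agree on a nonempty open convex
set are equal. -/
theorem ext_of_laplace_eqOn [SecondCountableTopology E] [CompleteSpace E]
    {D : Set (StrongDual ℝ E)} (hD : IsOpen D) (hDc : Convex ℝ D) (hDn : D.Nonempty)
    {a b : Measure E}
    (ha : ∀ L ∈ D, Integrable (fun y => Real.exp (L y)) a)
    (hb : ∀ L ∈ D, Integrable (fun y => Real.exp (L y)) b)
    (h : ∀ L ∈ D, laplace a L = laplace b L) : a = b := by
  obtain ⟨L, hL⟩ := hDn
  have := isFiniteMeasure_expTilt (ha L hL)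
  have := isFiniteMeasure_expTilt (hb L hL)
  have key : expTilt a L = expTilt b L := by
    refine Measure.ext_of_charFunDual (funext fun v => ?_)
    have hX : AnalyticOnNhd ℂ (complexMGF v (expTilt a L)) {z | L + z.re • v ∈ D} :=
      analyticOnNhd_complexMGF.mono fun z hz => subset_interior_integrableExpSet hD ha L v hz
    have hY : AnalyticOnNhd ℂ (complexMGF v (expTilt b L)) {z | L + z.re • v ∈ D} :=
      analyticOnNhd_complexMGF.mono fun z hz => subset_interior_integrableExpSet hD hb L v hz
    have h_real : ∀ᶠ x : ℝ in 𝓝[≠] 0,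
        complexMGF v (expTilt a L) x = complexMGF v (expTilt b L) x := by
      refine Filter.Eventually.filter_mono nhdsWithin_le_nhds ?_
      filter_upwards [(isOpen_preimage_line hD L v).mem_nhds (x := 0) (by simpa using hL)]
        with x hx
      rw [complexMGF_ofReal, complexMGF_ofReal, mgf_expTilt, mgf_expTilt, h _ hx]
    have h_tendsto : Filter.Tendsto (fun x : ℝ => (x : ℂ)) (𝓝[≠] 0) (𝓝[≠] 0) := by
      refine tendsto_nhdsWithin_of_tendsto_nhds_of_eventually_within _ ?_ ?_
      · exact (Complex.continuous_ofReal.tendsto' 0 0 (by simp)).mono_left nhdsWithin_le_nhds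
      · filter_upwards [self_mem_nhdsWithin] with x hx
        simpa using hx
    have hfreq := h_tendsto.frequently (p := fun z : ℂ =>
      complexMGF v (expTilt a L) z = complexMGF v (expTilt b L) z) h_real.frequently
    have hconn : IsPreconnected {z : ℂ | L + z.re • v ∈ D} :=
      ((convex_preimage_line hDc L v).linear_preimage Complex.reLm).isPreconnected
    have := AnalyticOnNhd.eqOn_of_preconnected_of_frequently_eq hX hY hconn
      (z₀ := 0) (by simpa using hL) hfreq (x := Complex.I) (by simpa using hL)
    simpa [complexMGF, charFunDual_apply, mul_comm] using this
  have hinv (e : Measure E) :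
      (expTilt e L).withDensity (fun y => (ENNReal.ofReal (Real.exp (L y)))⁻¹) = e :=
    withDensity_inv_same (measurable_ofReal_exp_dual L)
      (.of_forall fun y => by simp [Real.exp_pos]) (.of_forall fun y => by simp)
  rw [← hinv a, key, hinv b]

end LaplaceTransform

section Difference

variable {X : Type*} [MeasurableSpace X]

/-- The signed measure `ρ` is the difference `p - q` of two measures. -/
def IsDiff (ρ : SignedMeasure X) (p q : Measure X) : Prop :=
  ∀ S, MeasurableSet S → ρ S = p.real S - q.real S

theorem isDiff_jordan (ρ : SignedMeasure X) :
    IsDiff ρ ρ.toJordanDecomposition.posPart ρ.toJordanDecomposition.negPart :=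
  fun _ hS => ρ.apply_eq_posPart_real_sub_negPart_real hS

theorem isDiff_toSigned_sub (p q : Measure X) [IsFiniteMeasure p] [IsFiniteMeasure q] :
    IsDiff (toSigned p - toSigned q) p q := by
  intro S hS
  rw [toSigned, toSigned, dif_pos ‹_›, dif_pos ‹_›, Measure.toSignedMeasure_sub_apply hS]

theorem IsDiff.eq_zero_iff {ρ : SignedMeasure X} {p q : Measure X} [IsFiniteMeasure p]
    [IsFiniteMeasure q] (h : IsDiff ρ p q) : ρ = 0 ↔ p = q := by
  constructor
  · rintro rfl
    refine Measure.ext fun S hS => ?_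
    have := h S hS
    rw [← measureReal_eq_measureReal_iff]
    simp only [FunLike.coe_zero, Pi.zero_apply] at this
    linarith
  · rintro rfl
    ext S hS
    simp [h S hS]

theorem IsDiff.add_eq_add {ρ : SignedMeasure X} {p q p' q' : Measure X} [IsFiniteMeasure p]
    [IsFiniteMeasure q] [IsFiniteMeasure p'] [IsFiniteMeasure q']
    (h : IsDiff ρ p q) (h' : IsDiff ρ p' q') : p + q' = p' + q := by
  refine Measure.ext fun S hS => ?_
  rw [← measureReal_eq_measureReal_iff, measureReal_add_apply, measureReal_add_apply]
  linarith [h S hS, h' S hS]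

/-- The integral of `f` against the difference `p - q`. -/
def intDiff (p q : Measure X) (f : X → ℝ) : ℝ := (∫ x, f x ∂p) - ∫ x, f x ∂q

end Difference

section Convolution

variable {n : ℕ}

theorem measurable_vecMul :
    Measurable fun z : (Fin n → ℝ) × (Fin n → ℝ) => z.1 * z.2 :=
  measurable_fst.mul measurable_snd

instance isFiniteMeasure_mconvPos (p q : Measure (Fin n → ℝ)) [IsFiniteMeasure p]
    [IsFiniteMeasure q] : IsFiniteMeasure (mconvPos p q) := by
  unfold mconvPos; infer_instance

theorem mconvPos_add_left (p q r : Measure (Fin n → ℝ)) [IsFiniteMeasure p]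
    [IsFiniteMeasure q] [IsFiniteMeasure r] :
    mconvPos (p + q) r = mconvPos p r + mconvPos q r := by
  rw [mconvPos, Measure.add_prod, Measure.map_add _ _ measurable_vecMul]; rfl

theorem mconvPos_add_right (p q r : Measure (Fin n → ℝ)) [IsFiniteMeasure p]
    [IsFiniteMeasure q] [IsFiniteMeasure r] :
    mconvPos p (q + r) = mconvPos p q + mconvPos p r := by
  rw [mconvPos, Measure.prod_add, Measure.map_add _ _ measurable_vecMul]; rfl

theorem IsDiff.mconv {μ ν : SM n} {p q p' q' : Measure (Fin n → ℝ)} [IsFiniteMeasure p]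
    [IsFiniteMeasure q] [IsFiniteMeasure p'] [IsFiniteMeasure q']
    (h : IsDiff μ p q) (h' : IsDiff ν p' q') :
    IsDiff (mconv μ ν) (mconvPos p p' + mconvPos q q') (mconvPos p q' + mconvPos q p') := by
  intro S hS
  refine (isDiff_toSigned_sub _ _ S hS).trans ?_
  set a := μ.toJordanDecomposition.posPart
  set b := μ.toJordanDecomposition.negPart
  set a' := ν.toJordanDecomposition.posPart
  set b' := ν.toJordanDecomposition.negPart
  have hl (r : Measure (Fin n → ℝ)) [IsFiniteMeasure r] :
      (mconvPos a r).real S + (mconvPos q r).real S =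
        (mconvPos p r).real S + (mconvPos b r).real S := by
    rw [← measureReal_add_apply, ← measureReal_add_apply, ← mconvPos_add_left,
      ← mconvPos_add_left, (isDiff_jordan μ).add_eq_add h]
  have hr (r : Measure (Fin n → ℝ)) [IsFiniteMeasure r] :
      (mconvPos r a').real S + (mconvPos r q').real S =
        (mconvPos r p').real S + (mconvPos r b').real S := by
    rw [← measureReal_add_apply, ← measureReal_add_apply, ← mconvPos_add_right,
      ← mconvPos_add_right, (isDiff_jordan ν).add_eq_add h']
  rw [measureReal_add_apply, measureReal_add_apply, measureReal_add_apply, measureReal_add_apply]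
  linarith [hl a', hl b', hr p, hr q]

theorem integrable_mconvPos_of_mul {p q : Measure (Fin n → ℝ)} [IsFiniteMeasure p]
    [IsFiniteMeasure q] {f : (Fin n → ℝ) → ℝ} (hf : Measurable f)
    (hmul : ∀ x y, f (x * y) = f x * f y) (hp : Integrable f p) (hq : Integrable f q) :
    Integrable f (mconvPos p q) := by
  rw [mconvPos, integrable_map_measure hf.aestronglyMeasurable measurable_vecMul.aemeasurable]
  exact (hp.mul_prod hq).congr (.of_forall fun z => (hmul _ _).symm)

theorem integral_mconvPos_of_mul (p q : Measure (Fin n → ℝ)) [IsFiniteMeasure p]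
    [IsFiniteMeasure q] {f : (Fin n → ℝ) → ℝ} (hf : Measurable f)
    (hmul : ∀ x y, f (x * y) = f x * f y) :
    ∫ x, f x ∂(mconvPos p q) = (∫ x, f x ∂p) * ∫ x, f x ∂q := by
  rw [mconvPos, integral_map measurable_vecMul.aemeasurable hf.aestronglyMeasurable,
    ← integral_prod_mul]
  simp_rw [hmul]

theorem intDiff_mconv_of_mul {p q p' q' : Measure (Fin n → ℝ)} [IsFiniteMeasure p]
    [IsFiniteMeasure q] [IsFiniteMeasure p'] [IsFiniteMeasure q']
    {f : (Fin n → ℝ) → ℝ} (hf : Measurable f) (hmul : ∀ x y, f (x * y) = f x * f y)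
    (hp : Integrable f p) (hq : Integrable f q) (hp' : Integrable f p') (hq' : Integrable f q') :
    intDiff (mconvPos p p' + mconvPos q q') (mconvPos p q' + mconvPos q p') f =
      intDiff p q f * intDiff p' q' f := by
  rw [intDiff, integral_add_measure (integrable_mconvPos_of_mul hf hmul hp hp')
      (integrable_mconvPos_of_mul hf hmul hq hq'),
    integral_add_measure (integrable_mconvPos_of_mul hf hmul hp hq')
      (integrable_mconvPos_of_mul hf hmul hq hp')]
  simp only [integral_mconvPos_of_mul _ _ hf hmul, intDiff]
  ring

theorem integrable_of_abs_le_one {X : Type*} [MeasurableSpace X] (p : Measure X)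
    [IsFiniteMeasure p] {f : X → ℝ} (hf : Measurable f) (hb : ∀ x, |f x| ≤ 1) :
    Integrable f p :=
  .of_bound hf.aestronglyMeasurable 1 (.of_forall hb)

theorem integral_mconvPos (p q : Measure (Fin n → ℝ)) [IsFiniteMeasure p]
    [IsFiniteMeasure q] {f : (Fin n → ℝ) → ℝ} (hf : Measurable f) (hb : ∀ x, |f x| ≤ 1) :
    ∫ x, f x ∂(mconvPos p q) = ∫ y, ∫ x, f (x * y) ∂p ∂q := by
  rw [mconvPos, integral_map measurable_vecMul.aemeasurable hf.aestronglyMeasurable,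
    integral_prod_symm]
  exact integrable_of_abs_le_one _ (hf.comp measurable_vecMul) fun z => hb _

theorem intDiff_mconv {p q p' q' : Measure (Fin n → ℝ)} [IsFiniteMeasure p]
    [IsFiniteMeasure q] [IsFiniteMeasure p'] [IsFiniteMeasure q']
    {f : (Fin n → ℝ) → ℝ} (hf : Measurable f) (hb : ∀ x, |f x| ≤ 1) :
    intDiff (mconvPos p p' + mconvPos q q') (mconvPos p q' + mconvPos q p') f =
      intDiff p' q' fun y => intDiff p q fun x => f (x * y) := by
  have hint (r : Measure (Fin n → ℝ)) [IsFiniteMeasure r] : Integrable f r :=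
    integrable_of_abs_le_one r hf hb
  have hint2 (r s : Measure (Fin n → ℝ)) [IsFiniteMeasure r] [IsFiniteMeasure s] :
      Integrable (fun y => ∫ x, f (x * y) ∂r) s :=
    (integrable_of_abs_le_one (r.prod s) (hf.comp measurable_vecMul)
      fun z => hb _).integral_prod_right
  simp only [intDiff]
  rw [integral_add_measure (hint _) (hint _), integral_add_measure (hint _) (hint _),
    integral_sub (hint2 _ _) (hint2 _ _), integral_sub (hint2 _ _) (hint2 _ _)]
  simp only [integral_mconvPos _ _ hf hb]
  ring

end Convolution

section Characters

variable {n : ℕ}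

/-- The product of the signs of the coordinates in `J` (`0` if one of them vanishes). -/
def sgn (J : Finset (Fin n)) (x : Fin n → ℝ) : ℝ := ∏ j ∈ J, x j / |x j|

/-- The monomial `∏ᵢ |xᵢ| ^ tᵢ` with exponents `tᵢ = L eᵢ`. -/
def absPow (L : StrongDual ℝ (Fin n → ℝ)) (x : Fin n → ℝ) : ℝ :=
  ∏ i, |x i| ^ L (Pi.single i 1)

/-- The coordinatewise logarithm of the absolute value. -/
def logAbs (x : Fin n → ℝ) : Fin n → ℝ := fun i => Real.log (x i)

/-- The functionals with positive coordinates of sum less than `1`. -/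
def expDomain (n : ℕ) : Set (StrongDual ℝ (Fin n → ℝ)) :=
  {L | (∀ i, 0 < L (Pi.single i 1)) ∧ ∑ i, L (Pi.single i 1) < 1}

theorem isOpen_expDomain : IsOpen (expDomain n) := by
  have h (i : Fin n) : Continuous fun L : StrongDual ℝ (Fin n → ℝ) => L (Pi.single i 1) :=
    continuous_eval_const _
  rw [expDomain, Set.ofPred_and, Set.ofPred_forall]
  exact (isOpen_iInter_of_finite fun i => isOpen_lt continuous_const (h i)).inter
    (isOpen_lt (continuous_finsetSum _ fun i _ => h i) continuous_const)

theorem convex_expDomain : Convex ℝ (expDomain n) := by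
  intro L hL M hM a b ha hb hab
  refine ⟨fun i => ?_, ?_⟩
  · exact convex_Ioi (0 : ℝ) (hL.1 i) (hM.1 i) ha hb hab
  · have := convex_Iio (1 : ℝ) hL.2 hM.2 ha hb hab
    simpa [Finset.mul_sum, Finset.sum_add_distrib] using this

theorem nonempty_expDomain : (expDomain n).Nonempty := by
  refine ⟨∑ i, ((n : ℝ) + 1)⁻¹ • ContinuousLinearMap.proj i, fun i => ?_, ?_⟩
  · simp [Pi.single_apply]
    positivity
  · simp [Pi.single_apply, ← div_eq_mul_inv]
    rw [div_lt_one (by positivity)]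
    linarith

theorem measurable_sgn (J : Finset (Fin n)) : Measurable (sgn J) := by
  unfold sgn
  refine Finset.measurable_prod _ fun j _ => ?_
  exact (measurable_pi_apply j).div (measurable_pi_apply j).abs

theorem measurable_absPow (L : StrongDual ℝ (Fin n → ℝ)) : Measurable (absPow L) := by
  unfold absPow
  exact Finset.measurable_prod _ fun j _ => (measurable_pi_apply j).abs.pow_const _

theorem measurable_logAbs : Measurable (logAbs (n := n)) :=
  measurable_pi_lambda _ fun i => Real.measurable_log.comp (measurable_pi_apply i)

theorem sgn_mul (J : Finset (Fin n)) (x y : Fin n → ℝ) : sgn J (x * y) = sgn J x * sgn J y := by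
  simp only [sgn, ← Finset.prod_mul_distrib, Pi.mul_apply, abs_mul, mul_div_mul_comm]

theorem absPow_mul (L : StrongDual ℝ (Fin n → ℝ)) (x y : Fin n → ℝ) :
    absPow L (x * y) = absPow L x * absPow L y := by
  simp [absPow, ← Finset.prod_mul_distrib, abs_mul, Real.mul_rpow]

theorem abs_sgn_le_one (J : Finset (Fin n)) (x : Fin n → ℝ) : |sgn J x| ≤ 1 := by
  rw [sgn, Finset.abs_prod]
  refine Finset.prod_le_one (fun _ _ => abs_nonneg _) fun j _ => ?_
  rw [abs_div, abs_abs]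
  exact div_self_le_one _

theorem ne_zero_of_mem_setA_univ {x : Fin n → ℝ} (hx : x ∈ setA (Finset.univ : Finset (Fin n)))
    (i : Fin n) : x i ≠ 0 :=
  (hx i).2 (Finset.mem_univ i)

theorem abs_sgn {J : Finset (Fin n)} {x : Fin n → ℝ}
    (hx : x ∈ setA (Finset.univ : Finset (Fin n))) : |sgn J x| = 1 := by
  rw [sgn, Finset.abs_prod]
  refine Finset.prod_eq_one fun j _ => ?_
  rw [abs_div, abs_abs, div_self (abs_ne_zero.2 (ne_zero_of_mem_setA_univ hx j))]

theorem exp_logAbs {L : StrongDual ℝ (Fin n → ℝ)} {x : Fin n → ℝ}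
    (hx : x ∈ setA (Finset.univ : Finset (Fin n))) : Real.exp (L (logAbs x)) = absPow L x := by
  conv_lhs => rw [pi_eq_sum_univ' (logAbs x)]
  rw [map_sum, Real.exp_sum, absPow]
  refine Finset.prod_congr rfl fun i _ => ?_
  rw [Real.rpow_def_of_pos (abs_pos.2 (ne_zero_of_mem_setA_univ hx i)), Real.log_abs, map_smul,
    smul_eq_mul]
  rfl

theorem absPow_nonneg (L : StrongDual ℝ (Fin n → ℝ)) (x : Fin n → ℝ) : 0 ≤ absPow L x :=
  Finset.prod_nonneg fun _ _ => Real.rpow_nonneg (abs_nonneg _) _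

theorem abs_le_e2 (x : Fin n → ℝ) (i : Fin n) : |x i| ≤ e2 x := by
  rw [e2, ← Real.sqrt_sq_eq_abs]
  exact Real.sqrt_le_sqrt (Finset.single_le_sum (f := fun i => x i ^ 2)
    (fun _ _ => sq_nonneg _) (Finset.mem_univ i))

theorem absPow_le {L : StrongDual ℝ (Fin n → ℝ)} (hL : L ∈ expDomain n) (x : Fin n → ℝ) :
    absPow L x ≤ 1 + e2 x := by
  have h0 : 0 ≤ e2 x := Real.sqrt_nonneg _
  calc absPow L x ≤ ∏ i, (1 + e2 x) ^ L (Pi.single i 1) :=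
        Finset.prod_le_prod (fun _ _ => Real.rpow_nonneg (abs_nonneg _) _) fun i _ =>
          Real.rpow_le_rpow (abs_nonneg _) (by linarith [abs_le_e2 x i]) (hL.1 i).le
    _ = (1 + e2 x) ^ ∑ i, L (Pi.single i 1) :=
        (Real.rpow_sum_of_pos (by linarith) _ _).symm
    _ ≤ (1 + e2 x) ^ (1 : ℝ) := Real.rpow_le_rpow_of_exponent_le (by linarith) hL.2.le
    _ = 1 + e2 x := Real.rpow_one _

theorem measurable_e2 : Measurable (e2 (n := n)) := by
  unfold e2; fun_prop

theorem measurableSet_setA (E : Finset (Fin n)) : MeasurableSet (setA E) := by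
  have : setA E = ⋂ i, {x : Fin n → ℝ | x i ≠ 0 ↔ i ∈ E} := by ext; simp [setA]
  rw [this]
  refine MeasurableSet.iInter fun i => ?_
  have h : MeasurableSet {x : Fin n → ℝ | x i ≠ 0} :=
    (measurableSet_eq_fun (measurable_pi_apply i) measurable_const).compl
  by_cases hi : i ∈ E <;> simp only [hi, iff_true, iff_false]
  · exact h
  · exact h.compl

/-- `p` is concentrated on vectors with nonzero coordinates, and its monomial moments with
exponents in `expDomain n` are finite. -/
structure MonomialIntegrable (p : Measure (Fin n → ℝ)) : Prop where
  ae_mem : ∀ᵐ x ∂p, x ∈ setA (Finset.univ : Finset (Fin n))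
  integrable : ∀ L ∈ expDomain n, Integrable (absPow L) p

theorem MonomialIntegrable.of_lintegral {p : Measure (Fin n → ℝ)} [IsFiniteMeasure p]
    (hc : p (setA (Finset.univ : Finset (Fin n)))ᶜ = 0)
    (hi : ∫⁻ x, ENNReal.ofReal (e2 x) ∂p < ⊤) : MonomialIntegrable p where
  ae_mem := hc
  integrable L hL := by
    have he : Integrable e2 p :=
      ⟨measurable_e2.aestronglyMeasurable,
        (hasFiniteIntegral_iff_ofReal (.of_forall fun x => Real.sqrt_nonneg _)).2 hi⟩
    refine ((integrable_const (1 : ℝ)).add he).mono' (measurable_absPow L).aestronglyMeasurable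
      (.of_forall fun x => ?_)
    rw [Real.norm_of_nonneg (absPow_nonneg L x)]
    exact absPow_le hL x

theorem MonomialIntegrable.add {p q : Measure (Fin n → ℝ)} (hp : MonomialIntegrable p)
    (hq : MonomialIntegrable q) : MonomialIntegrable (p + q) where
  ae_mem := ae_add_measure_iff.2 ⟨hp.ae_mem, hq.ae_mem⟩
  integrable L hL := (hp.integrable L hL).add_measure (hq.integrable L hL)

theorem MonomialIntegrable.restrict {p : Measure (Fin n → ℝ)} (hp : MonomialIntegrable p)
    (S : Set (Fin n → ℝ)) : MonomialIntegrable (p.restrict S) where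
  ae_mem := ae_restrict_of_ae hp.ae_mem
  integrable L hL := (hp.integrable L hL).restrict

theorem MonomialIntegrable.mconvPos {p q : Measure (Fin n → ℝ)} [IsFiniteMeasure p]
    [IsFiniteMeasure q] (hp : MonomialIntegrable p) (hq : MonomialIntegrable q) :
    MonomialIntegrable (mconvPos p q) where
  ae_mem := by
    refine (ae_map_iff measurable_vecMul.aemeasurable (measurableSet_setA _)).2 ?_
    filter_upwards [Measure.quasiMeasurePreserving_fst.ae hp.ae_mem,
      Measure.quasiMeasurePreserving_snd.ae hq.ae_mem] with z h1 h2 i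
    simp [ne_zero_of_mem_setA_univ h1 i, ne_zero_of_mem_setA_univ h2 i]
  integrable L hL := integrable_mconvPos_of_mul (measurable_absPow L) (absPow_mul L)
    (hp.integrable L hL) (hq.integrable L hL)

theorem integrable_sgn_mul {p : Measure (Fin n → ℝ)} {f : (Fin n → ℝ) → ℝ} (hf : Integrable f p)
    (J : Finset (Fin n)) : Integrable (fun x => sgn J x * f x) p :=
  hf.bdd_mul (measurable_sgn J).aestronglyMeasurable (.of_forall (abs_sgn_le_one J))

/-- The law under `logAbs` of the positive part, for the sign character `sgn J`, of `p - q`. -/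
def logPart (J : Finset (Fin n)) (p q : Measure (Fin n → ℝ)) : Measure (Fin n → ℝ) :=
  (p.restrict {x | sgn J x = 1} + q.restrict {x | sgn J x = 1}ᶜ).map logAbs

theorem integral_sgn_mul {p : Measure (Fin n → ℝ)}
    (hp : ∀ᵐ x ∂p, x ∈ setA (Finset.univ : Finset (Fin n))) (J : Finset (Fin n))
    {f : (Fin n → ℝ) → ℝ} (hf : Integrable f p) :
    ∫ x, sgn J x * f x ∂p =
      (∫ x in {x | sgn J x = 1}, f x ∂p) - ∫ x in {x | sgn J x = 1}ᶜ, f x ∂p := by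
  have hS : MeasurableSet {x | sgn J x = 1} := measurable_sgn J (measurableSet_singleton 1)
  rw [← integral_add_compl hS (integrable_sgn_mul hf J), sub_eq_add_neg, ← integral_neg]
  congr 1
  · exact setIntegral_congr_fun hS fun x hx => by simp only [show sgn J x = 1 from hx, one_mul]
  · refine setIntegral_congr_ae hS.compl ?_
    filter_upwards [hp] with x hx hx1
    rw [((abs_eq zero_le_one).1 (abs_sgn hx)).resolve_left hx1, neg_one_mul]

theorem intDiff_sgn_mul {p q : Measure (Fin n → ℝ)} (hp : MonomialIntegrable p)
    (hq : MonomialIntegrable q) (J : Finset (Fin n)) {g : (Fin n → ℝ) → ℝ} (hg : Measurable g)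
    (hgp : Integrable (fun x => g (logAbs x)) p) (hgq : Integrable (fun x => g (logAbs x)) q) :
    intDiff p q (fun x => sgn J x * g (logAbs x)) = intDiff (logPart J p q) (logPart J q p) g := by
  rw [intDiff, integral_sgn_mul hp.ae_mem J hgp, integral_sgn_mul hq.ae_mem J hgq, intDiff,
    logPart, logPart, integral_map measurable_logAbs.aemeasurable hg.aestronglyMeasurable,
    integral_map measurable_logAbs.aemeasurable hg.aestronglyMeasurable,
    integral_add_measure hgp.restrict hgq.restrict, integral_add_measure hgq.restrict hgp.restrict]
  ring

theorem integrable_exp_logAbs {p : Measure (Fin n → ℝ)} (hp : MonomialIntegrable p)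
    {L : StrongDual ℝ (Fin n → ℝ)} (hL : L ∈ expDomain n) :
    Integrable (fun x => Real.exp (L (logAbs x))) p :=
  (hp.integrable L hL).congr (hp.ae_mem.mono fun _ hx => (exp_logAbs hx).symm)

theorem integrable_exp_logPart {p q : Measure (Fin n → ℝ)} (hp : MonomialIntegrable p)
    (hq : MonomialIntegrable q) (J : Finset (Fin n)) {L : StrongDual ℝ (Fin n → ℝ)}
    (hL : L ∈ expDomain n) : Integrable (fun y => Real.exp (L y)) (logPart J p q) := by
  rw [logPart, integrable_map_measure (by fun_prop) measurable_logAbs.aemeasurable]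
  exact integrable_exp_logAbs ((hp.restrict _).add (hq.restrict _)) hL

theorem intDiff_sgn_mul_absPow {p q : Measure (Fin n → ℝ)} (hp : MonomialIntegrable p)
    (hq : MonomialIntegrable q) (J : Finset (Fin n)) {L : StrongDual ℝ (Fin n → ℝ)}
    (hL : L ∈ expDomain n) :
    intDiff p q (fun x => sgn J x * absPow L x) =
      laplace (logPart J p q) L - laplace (logPart J q p) L := by
  refine Eq.trans ?_ (intDiff_sgn_mul hp hq J (g := fun y => Real.exp (L y)) (by fun_prop)
    (integrable_exp_logAbs hp hL) (integrable_exp_logAbs hq hL))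
  rw [intDiff, intDiff]
  congr 1
  · exact integral_congr_ae (hp.ae_mem.mono fun x hx => by simp only [exp_logAbs hx])
  · exact integral_congr_ae (hq.ae_mem.mono fun x hx => by simp only [exp_logAbs hx])

theorem logPart_eq_of_intDiff_eq_zero {p q : Measure (Fin n → ℝ)} (hp : MonomialIntegrable p)
    (hq : MonomialIntegrable q) (J : Finset (Fin n))
    (h : ∀ L ∈ expDomain n, intDiff p q (fun x => sgn J x * absPow L x) = 0) :
    logPart J p q = logPart J q p :=
  ext_of_laplace_eqOn isOpen_expDomain convex_expDomain nonempty_expDomain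
    (fun _ hL => integrable_exp_logPart hp hq J hL) (fun _ hL => integrable_exp_logPart hq hp J hL)
    fun L hL => sub_eq_zero.1 (by rw [← intDiff_sgn_mul_absPow hp hq J hL, h L hL])

end Characters

section SignAverage

variable {n : ℕ}

/-- The part of `deltaJ J` (for `ε = 1`), respectively of its negative (for `ε = -1`), carried by
the atoms of positive weight. -/
def deltaPart (J : Finset (Fin n)) (ε : ℝ) : Measure (Fin n → ℝ) :=
  ∑ b : Fin n → Bool,
    ENNReal.ofReal (ε * (((2 : ℝ) ^ n)⁻¹ * sgn J (signVec b))) • Measure.dirac (signVec b)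

instance isFiniteMeasure_deltaPart (J : Finset (Fin n)) (ε : ℝ) :
    IsFiniteMeasure (deltaPart J ε) :=
  ⟨by simp [deltaPart, ENNReal.sum_lt_top]⟩

theorem sgn_signVec (J : Finset (Fin n)) (b : Fin n → Bool) :
    sgn J (signVec b) = ∏ j ∈ J, (if b j then (1 : ℝ) else -1) := by
  refine Finset.prod_congr rfl fun j _ => ?_
  cases h : b j <;> simp [signVec, h]

theorem signVec_mem_setA (b : Fin n → Bool) :
    signVec b ∈ setA (Finset.univ : Finset (Fin n)) := by
  intro i
  cases h : b i <;> simp [signVec, h]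

theorem intDiff_deltaPart (J : Finset (Fin n)) (f : (Fin n → ℝ) → ℝ) :
    intDiff (deltaPart J 1) (deltaPart J (-1)) f =
      ((2 : ℝ) ^ n)⁻¹ * ∑ b : Fin n → Bool, sgn J (signVec b) * f (signVec b) := by
  have hi (c : ℝ) (b : Fin n → Bool) :
      Integrable f (ENNReal.ofReal c • Measure.dirac (signVec b)) :=
    (integrable_dirac (by finiteness)).smul_measure ENNReal.ofReal_ne_top
  rw [intDiff, deltaPart, deltaPart, integral_finsetSum_measure fun b _ => hi _ b,
    integral_finsetSum_measure fun b _ => hi _ b, ← Finset.sum_sub_distrib, Finset.mul_sum]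
  refine Finset.sum_congr rfl fun b _ => ?_
  rw [integral_smul_measure, integral_smul_measure, integral_dirac, ← sub_smul,
    ENNReal.toReal_ofReal', ENNReal.toReal_ofReal', one_mul, neg_one_mul,
    max_zero_sub_max_neg_zero_eq_self, smul_eq_mul, mul_assoc]

theorem isDiff_deltaJ (J : Finset (Fin n)) :
    IsDiff (deltaJ J) (deltaPart J 1) (deltaPart J (-1)) := by
  intro S hS
  have h := intDiff_deltaPart J (S.indicator 1)
  rw [intDiff, integral_indicator_one hS, integral_indicator_one hS] at h
  rw [h, deltaJ, _root_.smul_apply, _root_.sum_apply, smul_eq_mul]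
  congr 1
  refine Finset.sum_congr rfl fun b _ => ?_
  rw [_root_.smul_apply, sgn_signVec, toSigned,
    dif_pos (inferInstance : IsFiniteMeasure (Measure.dirac (signVec b))),
    Measure.toSignedMeasure_apply_measurable hS, smul_eq_mul, Measure.real,
    Measure.dirac_apply' _ hS]
  by_cases hb : signVec b ∈ S <;> simp [hb]

theorem sgn_signVec_mul_self (J : Finset (Fin n)) (b : Fin n → Bool) :
    sgn J (signVec b) * sgn J (signVec b) = 1 := by
  rw [← abs_mul_abs_self, abs_sgn (signVec_mem_setA b), one_mul]

theorem intDiff_deltaPart_sgn_mul_absPow (J : Finset (Fin n)) (L : StrongDual ℝ (Fin n → ℝ)) :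
    intDiff (deltaPart J 1) (deltaPart J (-1)) (fun x => sgn J x * absPow L x) = 1 := by
  have h (b : Fin n → Bool) : absPow L (signVec b) = 1 := by
    refine Finset.prod_eq_one fun i _ => ?_
    cases hb : b i <;> simp [signVec, hb]
  simp [intDiff_deltaPart, h, sgn_signVec_mul_self]

theorem integrable_deltaPart (J : Finset (Fin n)) (ε : ℝ) (f : (Fin n → ℝ) → ℝ) :
    Integrable f (deltaPart J ε) :=
  integrable_finsetSum_measure.2 fun _ _ =>
    (integrable_dirac (by finiteness)).smul_measure ENNReal.ofReal_ne_top

theorem signVec_beq (b c : Fin n → Bool) :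
    signVec (fun i => b i == c i) = signVec b * signVec c := by
  ext i
  cases hb : b i <;> cases hc : c i <;> simp [signVec, hb, hc]

theorem signVec_mul_exp_logAbs {x : Fin n → ℝ}
    (hx : x ∈ setA (Finset.univ : Finset (Fin n))) :
    (signVec fun i => decide (0 < x i)) * (fun i => Real.exp (logAbs x i)) = x := by
  ext i
  have := ne_zero_of_mem_setA_univ hx i
  rw [Pi.mul_apply, logAbs, Real.exp_log_eq_abs this, signVec]
  rcases this.lt_or_gt with h | h
  · simp [h.not_gt, abs_of_neg h]
  · simp [h, abs_of_pos h]

theorem sgn_signVec_pos {x : Fin n → ℝ} (hx : x ∈ setA (Finset.univ : Finset (Fin n)))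
    (J : Finset (Fin n)) : sgn J (signVec fun i => decide (0 < x i)) = sgn J x := by
  refine Finset.prod_congr rfl fun i _ => ?_
  rcases (ne_zero_of_mem_setA_univ hx i).lt_or_gt with h | h
  · simp [signVec, h.not_gt, abs_of_neg h, h.ne]
  · simp [signVec, h, abs_of_pos h, h.ne']

/-- The average `2⁻ⁿ ∑ₛ σ_J(s) f (s · x)` over the sign vectors is `sgn J x` times a function of
the absolute values of the coordinates of `x`. -/
theorem intDiff_deltaPart_mul (J : Finset (Fin n)) (f : (Fin n → ℝ) → ℝ) {x : Fin n → ℝ}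
    (hx : x ∈ setA (Finset.univ : Finset (Fin n))) :
    intDiff (deltaPart J 1) (deltaPart J (-1)) (fun s => f (s * x)) =
      sgn J x * intDiff (deltaPart J 1) (deltaPart J (-1))
        (fun s => f (s * fun i => Real.exp (logAbs x i))) := by
  set c : Fin n → Bool := fun i => decide (0 < x i) with hc
  have hinv : Function.Involutive fun (b : Fin n → Bool) i => b i == c i := by
    intro b; ext i; cases hb : b i <;> cases hc : c i <;> simp [hb, hc]
  rw [intDiff_deltaPart, intDiff_deltaPart, mul_left_comm]
  congr 1
  rw [Finset.mul_sum]
  rw [← Equiv.sum_comp hinv.toPerm]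
  refine Finset.sum_congr rfl fun b _ => ?_
  rw [Function.Involutive.coe_toPerm, signVec_beq, sgn_mul, ← sgn_signVec_pos hx J, ← hc]
  have : signVec b * signVec c * x = signVec b * fun i => Real.exp (logAbs x i) := by
    conv_lhs => rw [← signVec_mul_exp_logAbs hx, ← hc]
    ext i
    cases hci : c i <;> simp [signVec, hci]
  rw [this]
  ring

end SignAverage

section Main

variable {n : ℕ}

theorem mconv_deltaJ_eq_zero_iff (J : Finset (Fin n)) {ρ : SM n} {p q : Measure (Fin n → ℝ)}
    [IsFiniteMeasure p] [IsFiniteMeasure q] (hρ : IsDiff ρ p q) (hp : MonomialIntegrable p)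
    (hq : MonomialIntegrable q) :
    mconv (deltaJ J) ρ = 0 ↔
      ∀ L ∈ expDomain n, intDiff p q (fun x => sgn J x * absPow L x) = 0 := by
  have hdiff := (isDiff_deltaJ J).mconv hρ
  rw [hdiff.eq_zero_iff]
  constructor
  · intro h L hL
    have hmul := intDiff_mconv_of_mul (p := deltaPart J 1) (q := deltaPart J (-1))
      ((measurable_sgn J).mul (measurable_absPow L))
      (fun x y => by simp only [Pi.mul_apply, sgn_mul, absPow_mul]; ring)
      (integrable_deltaPart J _ _) (integrable_deltaPart J _ _)
      (integrable_sgn_mul (hp.integrable L hL) J) (integrable_sgn_mul (hq.integrable L hL) J)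
    rw [h] at hmul
    have hone := intDiff_deltaPart_sgn_mul_absPow J L
    rw [intDiff, sub_self] at hmul
    exact (mul_eq_zero.1 hmul.symm).resolve_left (hone.trans_ne one_ne_zero)
  · intro h
    have hlog := logPart_eq_of_intDiff_eq_zero hp hq J h
    rw [← hdiff.eq_zero_iff]
    ext S hS
    have hf : Measurable (S.indicator (1 : (Fin n → ℝ) → ℝ)) := measurable_one.indicator hS
    have hb (x) : |S.indicator (1 : (Fin n → ℝ) → ℝ) x| ≤ 1 := by
      by_cases hx : x ∈ S <;> simp [hx]
    have hint := intDiff_mconv (p := deltaPart J 1) (q := deltaPart J (-1)) (p' := p) (q' := q)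
      hf hb
    rw [intDiff, integral_indicator_one hS, integral_indicator_one hS, ← hdiff S hS] at hint
    set g : (Fin n → ℝ) → ℝ := fun y => intDiff (deltaPart J 1) (deltaPart J (-1))
      (fun s => S.indicator (1 : (Fin n → ℝ) → ℝ) (s * fun i => Real.exp (y i))) with hg
    have hgm : Measurable g := by
      simp only [hg, intDiff_deltaPart]
      refine (Finset.measurable_sum _ fun b _ => (hf.comp ?_).const_mul _).const_mul _
      exact measurable_pi_lambda _ fun i =>
        (Real.measurable_exp.comp (measurable_pi_apply i)).const_mul _
    have hgb (y) : |g y| ≤ 1 := by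
      simp only [hg, intDiff_deltaPart]
      rw [abs_mul, abs_of_nonneg (by positivity), inv_mul_le_iff₀ (by positivity), mul_one]
      refine (Finset.abs_sum_le_sum_abs _ _).trans ?_
      refine (Finset.sum_le_card_nsmul _ _ 1 fun b _ => ?_).trans (by simp)
      rw [abs_mul]
      exact mul_le_one₀ (abs_sgn_le_one J _) (abs_nonneg _) (hb _)
    have hgi (r : Measure (Fin n → ℝ)) [IsFiniteMeasure r] :
        Integrable (fun x => g (logAbs x)) r :=
      integrable_of_abs_le_one r (hgm.comp measurable_logAbs) fun x => hgb _
    have hfin := intDiff_sgn_mul hp hq J hgm (hgi p) (hgi q)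
    rw [hlog, intDiff, intDiff, sub_self] at hfin
    rw [hint, _root_.zero_apply, ← hfin, intDiff]
    congr 1
    · exact integral_congr_ae (hp.ae_mem.mono fun x hx => intDiff_deltaPart_mul J _ hx)
    · exact integral_congr_ae (hq.ae_mem.mono fun x hx => intDiff_deltaPart_mul J _ hx)

theorem monomialIntegrable_jordan {μ : SM n} (hi : IntegrableSM μ)
    (hc : ConcOn μ (setA (Finset.univ : Finset (Fin n)))) :
    MonomialIntegrable μ.toJordanDecomposition.posPart ∧
      MonomialIntegrable μ.toJordanDecomposition.negPart := by
  rw [IntegrableSM, SignedMeasure.totalVariation, lintegral_add_measure, ENNReal.add_lt_top] at hi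
  rw [ConcOn, SignedMeasure.totalVariation, Measure.add_apply, add_eq_zero] at hc
  exact ⟨.of_lintegral hc.1 hi.1, .of_lintegral hc.2 hi.2⟩

end Main

/-- Theorem: for integrable `μ, ν` concentrated on `A_{[n]}` and `J ⊆ [n]`,
`δ_J ⊛ μ ⊛ ν ≠ 0` iff `δ_J ⊛ μ ≠ 0` and `δ_J ⊛ ν ≠ 0`. -/
theorem stmt13 {n : ℕ} (hn : 1 ≤ n) (μ ν : SM n)
    (hμi : IntegrableSM μ) (hνi : IntegrableSM ν)
    (hμc : ConcOn μ (setA (Finset.univ : Finset (Fin n))))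
    (hνc : ConcOn ν (setA (Finset.univ : Finset (Fin n))))
    (J : Finset (Fin n)) :
    mconv (deltaJ J) (mconv μ ν) ≠ 0 ↔
      mconv (deltaJ J) μ ≠ 0 ∧ mconv (deltaJ J) ν ≠ 0 := by
  obtain ⟨hp, hq⟩ := monomialIntegrable_jordan hμi hμc
  obtain ⟨hp', hq'⟩ := monomialIntegrable_jordan hνi hνc
  have hμ := isDiff_jordan μ
  have hν := isDiff_jordan ν
  rw [← not_or, not_iff_not, mconv_deltaJ_eq_zero_iff J hμ hp hq,
    mconv_deltaJ_eq_zero_iff J hν hp' hq',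
    mconv_deltaJ_eq_zero_iff J (hμ.mconv hν) ((hp.mconvPos hp').add (hq.mconvPos hq'))
      ((hp.mconvPos hq').add (hq.mconvPos hp'))]
  have hmul (L) (hL : L ∈ expDomain n) :=
    intDiff_mconv_of_mul ((measurable_sgn J).mul (measurable_absPow L))
      (fun x y => by simp only [Pi.mul_apply, sgn_mul, absPow_mul]; ring)
      (integrable_sgn_mul (hp.integrable L hL) J) (integrable_sgn_mul (hq.integrable L hL) J)
      (integrable_sgn_mul (hp'.integrable L hL) J) (integrable_sgn_mul (hq'.integrable L hL) J)
  constructor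
  · intro h
    have h' := laplace_eq_or_eq_of_mul_eq_zero isOpen_expDomain convex_expDomain
      (fun _ hL => integrable_exp_logPart hp hq J hL)
      (fun _ hL => integrable_exp_logPart hq hp J hL)
      (fun _ hL => integrable_exp_logPart hp' hq' J hL)
      (fun _ hL => integrable_exp_logPart hq' hp' J hL)
      fun L hL => by
        rw [← intDiff_sgn_mul_absPow hp hq J hL, ← intDiff_sgn_mul_absPow hp' hq' J hL]
        exact (hmul L hL).symm.trans (h L hL)
    exact h'.imp (fun h L hL => (intDiff_sgn_mul_absPow hp hq J hL).trans (h L hL))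
      fun h L hL => (intDiff_sgn_mul_absPow hp' hq' J hL).trans (h L hL)
  · rintro (h | h) L hL
    · exact (hmul L hL).trans (mul_eq_zero_of_left (h L hL) _)
    · exact (hmul L hL).trans (mul_eq_zero_of_right _ (h L hL))

end
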